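/- Let k be a positive integer. (1) If B = {1, 2, 3, 4, 4(6k+1)}, then for every natural number n one has P_B(12(6k+1)n + 3(8k−1)) = (3n+2)·((6k+1)n + 2k)·(3(6k+1)²n² + 2(9k+1)(6k+1)n + 6k(4k+1)). (2) If B = {1, 2, 3, 4, 4(12k+2)}, then for every natural number n one has P_B(12(12k+2)n + 48k + 1) = (3n+1)·(2(6k+1)n + 8k+1)·(12(6k+1)²n² + 2(6k+1)(36k+5)n + 96k² + 24k + 1). -/

import Mathlib

/-- `partCount A n` is the number of partitions of `n` into parts from `A`. -/
def partCount (A : Finset ℕ) (n : ℕ) : ℕ :=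
  ((Finset.univ : Finset (Nat.Partition n)).filter (fun p => ∀ i ∈ p.parts, i ∈ A)).card

theorem partCount_insert_of_lt {A : Finset ℕ} {a n : ℕ} (h : n < a) :
    partCount (insert a A) n = partCount A n := by
  unfold partCount
  congr 1
  refine Finset.filter_congr fun p _ => forall₂_congr fun i hi => ?_
  have hle : i ≤ n := p.parts_sum ▸ Multiset.le_sum_of_mem hi
  simp only [Finset.mem_insert]
  constructor
  · rintro (rfl | h')
    · omega
    · exact h'
  · exact Or.inr

theorem partCount_insert_add {A : Finset ℕ} {a : ℕ} (n : ℕ) (ha : 0 < a) (hA : a ∉ A) :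
    partCount (insert a A) (n + a) = partCount (insert a A) n + partCount A (n + a) := by
  classical
  unfold partCount
  rw [← Finset.card_filter_add_card_filter_not
    (s := Finset.filter (fun p : Nat.Partition (n + a) => ∀ i ∈ p.parts, i ∈ insert a A) Finset.univ)
    (fun p => a ∈ p.parts)]
  congr 1
  · symm
    refine Finset.card_bij
      (fun p _ => ⟨a ::ₘ p.parts, ?_, by rw [Multiset.sum_cons, p.parts_sum, add_comm]⟩) ?_ ?_ ?_
    · intro i hi
      rcases Multiset.mem_cons.1 hi with rfl | hi
      · exact ha
      · exact p.parts_pos hi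
    · intro p hp
      simp only [Finset.mem_filter, Finset.mem_univ, true_and] at hp ⊢
      refine ⟨fun i hi => ?_, Multiset.mem_cons_self _ _⟩
      rcases Multiset.mem_cons.1 hi with rfl | hi
      · exact Finset.mem_insert_self _ _
      · exact hp i hi
    · intro p _ q _ h
      exact Nat.Partition.ext ((Multiset.cons_inj_right a).1 (congrArg Nat.Partition.parts h))
    · intro q hq
      simp only [Finset.mem_filter, Finset.mem_univ, true_and] at hq
      have hc := Multiset.cons_erase hq.2
      have hs : (q.parts.erase a).sum = n := by
        have h := q.parts_sum
        rw [← hc, Multiset.sum_cons] at h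
        omega
      refine ⟨⟨q.parts.erase a, fun hi => q.parts_pos (Multiset.mem_of_mem_erase hi), hs⟩, ?_, ?_⟩
      · simp only [Finset.mem_filter, Finset.mem_univ, true_and]
        exact fun i hi => hq.1 i (Multiset.mem_of_mem_erase hi)
      · exact Nat.Partition.ext hc
  · rw [Finset.filter_filter]
    congr 1
    refine Finset.filter_congr fun p _ => ⟨fun h i hi => ?_, fun h => ⟨fun i hi => ?_, fun hi => ?_⟩⟩
    · rcases Finset.mem_insert.1 (h.1 i hi) with rfl | h'
      · exact absurd hi h.2
      · exact h'
    · exact Finset.mem_insert_of_mem (h i hi)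
    · exact hA (h a hi)

theorem partCount_zero (A : Finset ℕ) : partCount A 0 = 1 := by
  unfold partCount
  rw [Finset.filter_true_of_mem, Finset.card_univ, Fintype.card_unique]
  intro p _ i hi
  have := Multiset.le_sum_of_mem hi
  have := p.parts_pos hi
  have := p.parts_sum
  omega

theorem partCount_empty {n : ℕ} (hn : 0 < n) : partCount ∅ n = 0 := by
  unfold partCount
  rw [Finset.card_eq_zero, Finset.filter_eq_empty_iff]
  intro p _ h
  have h0 : p.parts = 0 := Multiset.eq_zero_of_forall_notMem fun i hi => by simpa using h i hi
  have := p.parts_sum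
  rw [h0, Multiset.sum_zero] at this
  omega

theorem partCount_one (n : ℕ) : partCount {1} n = 1 := by
  induction n with
  | zero => exact partCount_zero _
  | succ n ih =>
    rw [← insert_empty_eq, partCount_insert_add n one_pos (by simp), insert_empty_eq, ih,
      partCount_empty (Nat.add_pos_right n one_pos)]

theorem partCount_two_one (n : ℕ) : partCount {2, 1} n = n / 2 + 1 := by
  induction n using Nat.strong_induction_on with
  | _ n ih =>
    rcases lt_or_ge n 2 with h | h
    · rw [partCount_insert_of_lt h, partCount_one]
      omega
    · obtain ⟨m, rfl⟩ := Nat.exists_eq_add_of_le' h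
      rw [partCount_insert_add m two_pos (by simp), ih m (by omega), partCount_one]
      omega

theorem partCount_three_two_one_add_six (n : ℕ) :
    partCount {3, 2, 1} (n + 6) = partCount {3, 2, 1} n + n + 6 := by
  rw [show n + 6 = n + 3 + 3 from rfl, partCount_insert_add (n + 3) three_pos (by simp),
    partCount_insert_add n three_pos (by simp), partCount_two_one, partCount_two_one]
  omega

theorem partCount_three_two_one_of_lt {n : ℕ} (hn : n < 3) :
    partCount {3, 2, 1} n = n / 2 + 1 := by
  rw [partCount_insert_of_lt hn, partCount_two_one]

theorem partCount_three_two_one_add_three {n : ℕ} (hn : n < 3) :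
    partCount {3, 2, 1} (n + 3) = n / 2 + 1 + ((n + 3) / 2 + 1) := by
  rw [partCount_insert_add n three_pos (by simp), partCount_three_two_one_of_lt hn,
    partCount_two_one]

theorem partCount_three_two_one (q : ℕ) :
    partCount {3, 2, 1} (12 * q + 1) = 12 * q ^ 2 + 8 * q + 1 ∧
    partCount {3, 2, 1} (12 * q + 5) = 12 * q ^ 2 + 16 * q + 5 ∧
    partCount {3, 2, 1} (12 * q + 9) = 12 * q ^ 2 + 24 * q + 12 := by
  induction q with
  | zero =>
    have h1 := partCount_three_two_one_of_lt (n := 1) (by norm_num)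
    have h5 := partCount_three_two_one_add_three (n := 2) (by norm_num)
    have h3 := partCount_three_two_one_add_three (n := 0) (by norm_num)
    have h9 := partCount_three_two_one_add_six 3
    norm_num at h1 h5 h3 h9 ⊢
    omega
  | succ q ih =>
    obtain ⟨h1, h5, h9⟩ := ih
    have step (m : ℕ) : partCount {3, 2, 1} (m + 12) = partCount {3, 2, 1} m + 2 * m + 18 := by
      rw [show m + 12 = m + 6 + 6 from rfl, partCount_three_two_one_add_six,
        partCount_three_two_one_add_six]
      ring
    refine ⟨?_, ?_, ?_⟩
    · rw [show 12 * (q + 1) + 1 = 12 * q + 1 + 12 by ring, step, h1]; ring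
    · rw [show 12 * (q + 1) + 5 = 12 * q + 5 + 12 by ring, step, h5]; ring
    · rw [show 12 * (q + 1) + 9 = 12 * q + 9 + 12 by ring, step, h9]; ring

theorem partCount_four_three_two_one_add_four (n : ℕ) :
    partCount {4, 3, 2, 1} (n + 4) = partCount {4, 3, 2, 1} n + partCount {3, 2, 1} (n + 4) :=
  partCount_insert_add n four_pos (by simp)

theorem partCount_four_three_two_one (q : ℕ) :
    partCount {4, 3, 2, 1} (12 * q + 1) = 12 * q ^ 3 + 18 * q ^ 2 + 8 * q + 1 ∧
    partCount {4, 3, 2, 1} (12 * q + 5) = 12 * q ^ 3 + 30 * q ^ 2 + 24 * q + 6 ∧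
    partCount {4, 3, 2, 1} (12 * q + 9) = 12 * q ^ 3 + 42 * q ^ 2 + 48 * q + 18 := by
  have main : partCount {4, 3, 2, 1} (12 * q + 1) = 12 * q ^ 3 + 18 * q ^ 2 + 8 * q + 1 →
      partCount {4, 3, 2, 1} (12 * q + 5) = 12 * q ^ 3 + 30 * q ^ 2 + 24 * q + 6 ∧
      partCount {4, 3, 2, 1} (12 * q + 9) = 12 * q ^ 3 + 42 * q ^ 2 + 48 * q + 18 := by
    intro h1
    obtain ⟨-, h5, h9⟩ := partCount_three_two_one q
    have h5' := partCount_four_three_two_one_add_four (12 * q + 1)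
    have h9' := partCount_four_three_two_one_add_four (12 * q + 5)
    simp only [add_assoc, Nat.reduceAdd] at h5' h9'
    constructor <;> linarith
  suffices h : partCount {4, 3, 2, 1} (12 * q + 1) = 12 * q ^ 3 + 18 * q ^ 2 + 8 * q + 1 from
    ⟨h, main h⟩
  clear main
  induction q with
  | zero =>
    rw [partCount_insert_of_lt (by norm_num), partCount_three_two_one_of_lt (by norm_num)]
    norm_num
  | succ q ih =>
    obtain ⟨-, h5, h9⟩ := partCount_three_two_one q
    obtain ⟨h13, -, -⟩ := partCount_three_two_one (q + 1)
    rw [show 12 * (q + 1) + 1 = 12 * q + 1 + 4 + 4 + 4 by ring] at h13 ⊢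
    rw [partCount_four_three_two_one_add_four, partCount_four_three_two_one_add_four,
      partCount_four_three_two_one_add_four, ih, h13, h5, h9]
    ring

theorem partCount_insert_add_three_mul {A : Finset ℕ} {a : ℕ} (n : ℕ) (ha : 0 < a)
    (hA : a ∉ A) :
    partCount (insert a A) (n + 3 * a) = partCount (insert a A) n +
      (partCount A (n + a) + partCount A (n + 2 * a) + partCount A (n + 3 * a)) := by
  rw [show n + 3 * a = n + a + a + a by ring, show n + 2 * a = n + a + a by ring,
    partCount_insert_add _ ha hA, partCount_insert_add _ ha hA, partCount_insert_add _ ha hA]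
  ring

theorem stmt6 (k : ℕ) (hk : 0 < k) :
    (∀ n : ℕ,
      partCount {1, 2, 3, 4, 4 * (6 * k + 1)} (12 * (6 * k + 1) * n + 3 * (8 * k - 1)) =
        (3 * n + 2) * ((6 * k + 1) * n + 2 * k) *
          (3 * (6 * k + 1) ^ 2 * n ^ 2 + 2 * (9 * k + 1) * (6 * k + 1) * n +
            6 * k * (4 * k + 1))) ∧
    (∀ n : ℕ,
      partCount {1, 2, 3, 4, 4 * (12 * k + 2)} (12 * (12 * k + 2) * n + 48 * k + 1) =
        (3 * n + 1) * (2 * (6 * k + 1) * n + 8 * k + 1) *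
          (12 * (6 * k + 1) ^ 2 * n ^ 2 + 2 * (6 * k + 1) * (36 * k + 5) * n +
            96 * k ^ 2 + 24 * k + 1)) := by
  have reorder (a : ℕ) : ({1, 2, 3, 4, a} : Finset ℕ) = insert a {4, 3, 2, 1} := by
    ext i
    simp only [Finset.mem_insert, Finset.mem_singleton]
    tauto
  rw [reorder, reorder]
  constructor
  · obtain ⟨l, rfl⟩ := Nat.exists_eq_add_of_le' hk
    rw [show 3 * (8 * (l + 1) - 1) = 24 * l + 21 by omega]
    intro n
    induction n with
    | zero =>
      rw [partCount_insert_of_lt (by omega),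
        show 12 * (6 * (l + 1) + 1) * 0 + (24 * l + 21) = 12 * (2 * l + 1) + 9 by ring,
        (partCount_four_three_two_one _).2.2]
      ring
    | succ n ih =>
      rw [show 12 * (6 * (l + 1) + 1) * (n + 1) + (24 * l + 21) =
          12 * (6 * (l + 1) + 1) * n + (24 * l + 21) + 3 * (4 * (6 * (l + 1) + 1)) by ring,
        partCount_insert_add_three_mul _ (by omega)
          (by simp only [Finset.mem_insert, Finset.mem_singleton]; omega), ih,
        show 12 * (6 * (l + 1) + 1) * n + (24 * l + 21) + 4 * (6 * (l + 1) + 1) =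
          12 * ((6 * l + 7) * n + 4 * l + 4) + 1 by ring,
        show 12 * (6 * (l + 1) + 1) * n + (24 * l + 21) + 2 * (4 * (6 * (l + 1) + 1)) =
          12 * ((6 * l + 7) * n + 6 * l + 6) + 5 by ring,
        show 12 * (6 * (l + 1) + 1) * n + (24 * l + 21) + 3 * (4 * (6 * (l + 1) + 1)) =
          12 * ((6 * l + 7) * n + 8 * l + 8) + 9 by ring,
        (partCount_four_three_two_one _).1, (partCount_four_three_two_one _).2.1,
        (partCount_four_three_two_one _).2.2]
      ring
  · intro n
    induction n with
    | zero =>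
      rw [partCount_insert_of_lt (by omega),
        show 12 * (12 * k + 2) * 0 + 48 * k + 1 = 12 * (4 * k) + 1 by ring,
        (partCount_four_three_two_one _).1]
      ring
    | succ n ih =>
      rw [show 12 * (12 * k + 2) * (n + 1) + 48 * k + 1 =
          12 * (12 * k + 2) * n + 48 * k + 1 + 3 * (4 * (12 * k + 2)) by ring,
        partCount_insert_add_three_mul _ (by omega)
          (by simp only [Finset.mem_insert, Finset.mem_singleton]; omega), ih,
        show 12 * (12 * k + 2) * n + 48 * k + 1 + 4 * (12 * k + 2) =
          12 * ((12 * k + 2) * n + 8 * k) + 9 by ring,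
        show 12 * (12 * k + 2) * n + 48 * k + 1 + 2 * (4 * (12 * k + 2)) =
          12 * ((12 * k + 2) * n + 12 * k + 1) + 5 by ring,
        show 12 * (12 * k + 2) * n + 48 * k + 1 + 3 * (4 * (12 * k + 2)) =
          12 * ((12 * k + 2) * n + 16 * k + 2) + 1 by ring,
        (partCount_four_three_two_one _).1, (partCount_four_three_two_one _).2.1,
        (partCount_four_three_two_one _).2.2]
      ring
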